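/- Let T be an integer with |T| > 11. If P, Q are Gaussian integers such that P⁴ − 2iT²P²Q² + Q⁴ is a unit of Z[i], then there exist units ε, δ of Z[i] and a pair (p, q) among (1, 0), (0, 1), (1, (1+i)T), ((1+i)T, 1) such that P = ε·p and Q = δ·q. -/

import Mathlib

/-- coefficients of the Skolem series -/
def skG (n j : ℕ) : ℤ :=
  ∑ x ∈ Finset.HasAntidiagonal.antidiagonal (4 * j + 3),
    if Even x.2 then (-1) ^ (x.2 / 2) * (n.choose x.1 : ℤ) * (n.choose x.2 : ℤ) else 0

lemma desc_neg_one (a : ℕ) : (descPochhammer ℤ a).eval (-1) = (-1) ^ a * (a.factorial : ℤ) := by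
  induction a with
  | zero => simp
  | succ a ih =>
    rw [descPochhammer_succ_eval, ih, Nat.factorial_succ]
    push_cast
    ring

lemma alt_sum (j : ℕ) :
    ∑ b ∈ Finset.range (4 * j + 4), (if Even b then (-1 : ℤ) ^ (b / 2) else 0) = 0 := by
  induction j with
  | zero => decide
  | succ j ih =>
    rw [show 4 * (j + 1) + 4 = 4 * j + 4 + 1 + 1 + 1 + 1 by ring]
    rw [Finset.sum_range_succ, Finset.sum_range_succ, Finset.sum_range_succ,
      Finset.sum_range_succ, ih]
    have e0 : Even (4 * j + 4) := ⟨2 * j + 2, by ring⟩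
    have e1 : ¬ Even (4 * j + 4 + 1) := by rw [Nat.not_even_iff_odd]; exact ⟨2 * j + 2, by ring⟩
    have e2 : Even (4 * j + 4 + 1 + 1) := ⟨2 * j + 3, by ring⟩
    have e3 : ¬ Even (4 * j + 4 + 1 + 1 + 1) := by
      rw [Nat.not_even_iff_odd]; exact ⟨2 * j + 3, by ring⟩
    rw [if_pos e0, if_neg e1, if_pos e2, if_neg e3]
    rw [show (4 * j + 4) / 2 = 2 * (j + 1) by omega,
      show (4 * j + 4 + 1 + 1) / 2 = 2 * (j + 1) + 1 by omega]
    simp [pow_succ, pow_mul]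

open Polynomial in
lemma skG_div (n j : ℕ) :
    ∃ h : ℤ, ((4 * j + 3).factorial : ℤ) * skG n j = (n : ℤ) * ((n : ℤ) ^ 2 - 1) * h := by
  set g : ℤ[X] := ∑ x ∈ Finset.HasAntidiagonal.antidiagonal (4 * j + 3),
    if Even x.2 then C ((-1 : ℤ) ^ (x.2 / 2) * ((4 * j + 3).choose x.2 : ℤ)) *
      (descPochhammer ℤ x.1 * descPochhammer ℤ x.2) else 0 with hg
  have hev : ∀ t : ℤ, g.eval t = ∑ x ∈ Finset.HasAntidiagonal.antidiagonal (4 * j + 3),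
      if Even x.2 then ((-1 : ℤ) ^ (x.2 / 2) * ((4 * j + 3).choose x.2 : ℤ)) *
      ((descPochhammer ℤ x.1).eval t * (descPochhammer ℤ x.2).eval t) else 0 := by
    intro t
    rw [hg, eval_finsetSum]
    refine Finset.sum_congr rfl fun x _ => ?_
    split_ifs <;> simp
  have hn : g.eval (n : ℤ) = ((4 * j + 3).factorial : ℤ) * skG n j := by
    rw [hev, skG, Finset.mul_sum]
    refine Finset.sum_congr rfl fun x hx => ?_
    rw [Finset.HasAntidiagonal.mem_antidiagonal] at hx
    split_ifs
    · rw [descPochhammer_eval_eq_descFactorial, descPochhammer_eval_eq_descFactorial,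
        Nat.descFactorial_eq_factorial_mul_choose, Nat.descFactorial_eq_factorial_mul_choose]
      have := Nat.add_choose_mul_factorial_mul_factorial x.1 x.2
      rw [hx] at this
      rw [← this]
      push_cast
      ring
    · simp
  have h0 : g.eval 0 = 0 := by
    rw [hev]
    refine Finset.sum_eq_zero fun x hx => ?_
    rw [Finset.HasAntidiagonal.mem_antidiagonal] at hx
    split_ifs with h
    · have := descPochhammer_eval_eq_descFactorial ℤ 0 x.1
      rw [Nat.descFactorial_of_lt (by obtain ⟨k, hk⟩ := h; omega)] at this
      simp at this
      simp [this]
    · rfl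
  have h1 : g.eval 1 = 0 := by
    rw [hev]
    refine Finset.sum_eq_zero fun x hx => ?_
    rw [Finset.HasAntidiagonal.mem_antidiagonal] at hx
    split_ifs with h
    · have e1 := descPochhammer_eval_eq_descFactorial ℤ 1 x.1
      have e2 := descPochhammer_eval_eq_descFactorial ℤ 1 x.2
      by_cases hc : 1 < x.1
      · rw [Nat.descFactorial_of_lt hc] at e1
        simp at e1
        simp [e1]
      · rw [Nat.descFactorial_of_lt (by omega)] at e2
        simp at e2
        simp [e2]
    · rfl
  have hm : g.eval (-1) = 0 := by
    rw [hev]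
    have : ∀ x ∈ Finset.HasAntidiagonal.antidiagonal (4 * j + 3),
      (if Even x.2 then ((-1 : ℤ) ^ (x.2 / 2) * ((4 * j + 3).choose x.2 : ℤ)) *
      ((descPochhammer ℤ x.1).eval (-1) * (descPochhammer ℤ x.2).eval (-1)) else 0)
      = -((4 * j + 3).factorial : ℤ) * (if Even x.2 then (-1 : ℤ) ^ (x.2 / 2) else 0) := by
      intro x hx
      rw [Finset.HasAntidiagonal.mem_antidiagonal] at hx
      split_ifs with h
      · rw [desc_neg_one, desc_neg_one]
        have := Nat.add_choose_mul_factorial_mul_factorial x.1 x.2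
        rw [hx] at this
        rw [← this]
        have hodd : Odd x.1 := by
          obtain ⟨k, hk⟩ := h
          exact ⟨2 * j + 1 - k, by omega⟩
        rw [h.neg_one_pow, hodd.neg_one_pow]
        push_cast
        ring
      · simp
    rw [Finset.sum_congr rfl this, ← Finset.mul_sum,
      Finset.Nat.sum_antidiagonal_eq_sum_range_succ_mk]
    have h2 := alt_sum j
    rw [← Finset.sum_range_reflect] at h2
    simp only [Nat.succ_eq_add_one]
    rw [mul_eq_zero]; right
    refine Eq.trans ?_ h2
    refine Finset.sum_congr rfl fun x _ => ?_
    simp only [show 4 * j + 4 - 1 - x = 4 * j + 3 - x by omega]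
  obtain ⟨g1, hg1⟩ := dvd_iff_isRoot.mpr (show g.IsRoot 0 from h0)
  have h1' : g1.IsRoot 1 := by
    rw [hg1] at h1
    simpa using h1
  obtain ⟨g2, hg2⟩ := dvd_iff_isRoot.mpr h1'
  have h2' : g2.IsRoot (-1) := by
    rw [hg1, hg2] at hm
    simpa using hm
  obtain ⟨g3, hg3⟩ := dvd_iff_isRoot.mpr h2'
  refine ⟨g3.eval (n : ℤ), ?_⟩
  rw [← hn, hg1, hg2, hg3]
  simp
  ring

lemma skG_zero (n : ℕ) : 3 * skG n 0 = -((n : ℤ) * ((n : ℤ) ^ 2 - 1)) := by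
  have h2 : (n : ℤ) * (n - 1) = 2 * (n.choose 2 : ℤ) := by
    have := Nat.descFactorial_eq_factorial_mul_choose n 2
    have e := descPochhammer_eval_eq_descFactorial ℤ n 2
    rw [this] at e
    simp [descPochhammer_succ_eval, Nat.factorial] at e
    linarith
  have h3 : (n : ℤ) * (n - 1) * (n - 2) = 6 * (n.choose 3 : ℤ) := by
    have := Nat.descFactorial_eq_factorial_mul_choose n 3
    have e := descPochhammer_eval_eq_descFactorial ℤ n 3
    rw [this] at e
    simp [descPochhammer_succ_eval, Nat.factorial] at e
    linarith
  have : skG n 0 = (n.choose 3 : ℤ) - n * (n.choose 2 : ℤ) := by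
    simp [skG, Finset.Nat.antidiagonal_succ]
    norm_num
    ring
  rw [this]
  apply mul_left_cancel₀ (two_ne_zero (α := ℤ)); linear_combination (-1:ℤ) * h3 + 3 * (n:ℤ) * h2

lemma fact_dvd (p : ℕ) [hp : Fact p.Prime] (T : ℤ)
    (hT : (3 ≤ p ∧ (p : ℤ) ∣ T) ∨ (p = 2 ∧ (4 : ℤ) ∣ T)) (j : ℕ) (hj : 1 ≤ j) :
    ((p : ℤ) ^ (padicValNat p (4 * j + 3).factorial + 1)) ∣ T ^ (4 * j) := by
  have h := sub_one_mul_padicValNat_factorial (p := p) (4 * j + 3)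
  have hd : 1 ≤ (p.digits (4 * j + 3)).sum := by
    by_contra hc
    have h0 : (p.digits (4 * j + 3)).sum = 0 := by omega
    have := Nat.modEq_digits_sum
    have h1 := Nat.ofDigits_digits p (4 * j + 3)
    have h2 : ∀ x ∈ p.digits (4 * j + 3), x = 0 := by
      intro x hx
      exact (List.sum_eq_zero_iff.mp h0) x hx
    have h3 := Nat.getLast_digit_ne_zero p (m := 4 * j + 3) (by omega)
    exact h3 (h2 _ (List.getLast_mem _))
  set v := padicValNat p (4 * j + 3).factorial
  rcases hT with ⟨h3, hd'⟩ | ⟨h2, hd'⟩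
  · have : 2 * v ≤ (p - 1) * v := Nat.mul_le_mul_right _ (by omega)
    exact (pow_dvd_pow _ (by omega)).trans (pow_dvd_pow_of_dvd hd' _)
  · subst h2
    have : v + 1 ≤ 2 * (4 * j) := by omega
    refine (pow_dvd_pow _ this).trans ?_
    rw [pow_mul]
    exact pow_dvd_pow_of_dvd (by norm_num; exact hd') _

lemma skolem_padic (p : ℕ) [hp : Fact p.Prime] (T : ℤ)
    (hT : (3 ≤ p ∧ (p : ℤ) ∣ T) ∨ (p = 2 ∧ (4 : ℤ) ∣ T)) (n J : ℕ)
    (hs : ∑ j ∈ Finset.range (J + 1), (skG n j : ℚ) * ((T : ℚ) ^ 4 / ((T : ℚ) ^ 4 + 1)) ^ j = 0) :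
    (n : ℤ) * ((n : ℤ) ^ 2 - 1) = 0 := by
  by_contra hM
  set M : ℤ := (n : ℤ) * ((n : ℤ) ^ 2 - 1) with hMdef
  choose h hh using skG_div n
  have hpT : (p : ℤ) ∣ T := by
    rcases hT with ⟨_, hd⟩ | ⟨h2, hd⟩
    · exact hd
    · subst h2; exact (by norm_num : ((2 : ℕ) : ℤ) ∣ 4).trans hd
  have h0 : h 0 = -2 := by
    have a := hh 0
    have b := skG_zero n
    rw [← hMdef] at a b
    simp [Nat.factorial] at a
    have : M * (h 0 + 2) = 0 := by linarith
    rcases mul_eq_zero.mp this with h | h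
    · exact absurd h hM
    · linarith
  have hMQ : (M : ℚ_[p]) ≠ 0 := by exact_mod_cast hM
  have hG : ∀ j, ((skG n j : ℤ) : ℚ_[p]) = M * (h j / ((4 * j + 3).factorial : ℚ_[p])) := by
    intro j
    have hf : ((4 * j + 3).factorial : ℚ_[p]) ≠ 0 := by exact_mod_cast Nat.factorial_ne_zero _
    have := hh j
    rw [← hMdef] at this
    have e : (((4 * j + 3).factorial : ℚ_[p])) * ((skG n j : ℤ) : ℚ_[p]) = M * h j := by
      exact_mod_cast this
    field_simp
    linear_combination e
  set w : ℚ_[p] := (T : ℚ_[p]) ^ 4 / ((T : ℚ_[p]) ^ 4 + 1) with hw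
  have hs' : ∑ j ∈ Finset.range (J + 1), (h j / ((4 * j + 3).factorial : ℚ_[p])) * w ^ j = 0 := by
    have := congrArg (fun x : ℚ => (x : ℚ_[p])) hs
    simp only [Rat.cast_sum, Rat.cast_mul, Rat.cast_pow, Rat.cast_div, Rat.cast_add,
      Rat.cast_intCast, Rat.cast_one, Rat.cast_zero] at this
    simp only [hG] at this
    simp only [mul_assoc] at this
    rw [← Finset.mul_sum] at this
    rcases mul_eq_zero.mp this with h | h
    · exact absurd h hMQ
    · exact h
  have hD : ‖(T : ℚ_[p]) ^ 4 + 1‖ = 1 := by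
    have : ‖((T ^ 4 + 1 : ℤ) : ℚ_[p])‖ = 1 := by
      by_contra hne
      have hlt := lt_of_le_of_ne (Padic.norm_int_le_one (p := p) (T ^ 4 + 1)) hne
      rw [Padic.norm_intCast_lt_one_iff] at hlt
      have h1 : (p : ℤ) ∣ 1 := by
        have := Int.dvd_sub hlt (dvd_pow hpT (n := 4) (by norm_num))
        simpa using this
      have := Int.natAbs_dvd_natAbs.mpr h1
      simp at this
      exact hp.out.one_lt.ne' this
    simpa using this
  have hterm : ∀ j, 1 ≤ j → ‖(h j / ((4 * j + 3).factorial : ℚ_[p])) * w ^ j‖ < 1 := by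
    intro j hj
    have hnw : ‖w ^ j‖ = ‖((T ^ (4 * j) : ℤ) : ℚ_[p])‖ := by
      rw [hw, div_pow, norm_div, norm_pow (_ + _), hD]
      simp [pow_mul]
    have hfact : ‖((4 * j + 3).factorial : ℚ_[p])‖
        = (p : ℝ) ^ (-(padicValNat p (4 * j + 3).factorial : ℤ)) := by
      rw [Padic.norm_eq_zpow_neg_valuation
        (by exact_mod_cast Nat.factorial_ne_zero _), Padic.valuation_natCast]
    have hle := (Padic.norm_int_le_pow_iff_dvd (p := p) (T ^ (4 * j))
      (padicValNat p (4 * j + 3).factorial + 1)).mpr (by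
        have := fact_dvd p T hT j hj
        exact_mod_cast this)
    have hp1 : (1 : ℝ) < p := by exact_mod_cast hp.out.one_lt
    have hlt : ‖w ^ j‖ < ‖((4 * j + 3).factorial : ℚ_[p])‖ := by
      rw [hnw, hfact]
      refine lt_of_le_of_lt hle ?_
      apply zpow_lt_zpow_right₀ hp1
      push_cast
      linarith
    have hpos : 0 < ‖((4 * j + 3).factorial : ℚ_[p])‖ := lt_of_le_of_lt (norm_nonneg _) hlt
    rw [norm_mul, norm_div, div_mul_eq_mul_div, div_lt_one hpos]
    calc ‖(h j : ℚ_[p])‖ * ‖w ^ j‖ ≤ 1 * ‖w ^ j‖ :=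
          mul_le_mul_of_nonneg_right (Padic.norm_int_le_one _) (norm_nonneg _)
      _ < _ := by rw [one_mul]; exact hlt
  have hsum : ∀ K, ‖∑ j ∈ Finset.range K,
      (h (j + 1) / ((4 * (j + 1) + 3).factorial : ℚ_[p])) * w ^ (j + 1)‖ < 1 := by
    intro K
    induction K with
    | zero => simp
    | succ K ih =>
      rw [Finset.sum_range_succ]
      refine lt_of_le_of_lt (Padic.nonarchimedean _ _) ?_
      exact max_lt ih (hterm _ (by omega))
  rw [Finset.sum_range_succ'] at hs'
  have hk := hsum J
  rw [eq_neg_of_add_eq_zero_left hs', norm_neg, h0] at hk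
  have h3 : ‖(3 : ℚ_[p])‖ ≤ 1 := by
    have := Padic.norm_int_le_one (p := p) 3
    simpa using this
  have h3' : 0 < ‖(3 : ℚ_[p])‖ := norm_pos_iff.mpr (by norm_num)
  have e : (((-2 : ℤ) : ℚ_[p]) / ((4 * 0 + 3).factorial : ℚ_[p])) * w ^ 0 = - (1 / 3) := by
    simp [Nat.factorial]; norm_num
  rw [e, norm_neg, norm_div, norm_one, div_lt_one h3'] at hk
  linarith

open Polynomial in
lemma coeff_q (c : ℂ) (n a : ℕ) : ((1 + C c * X : ℂ[X]) ^ n).coeff a = n.choose a * c ^ a := by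
  have : (1 + C c * X : ℂ[X]) ^ n = ((1 + X : ℂ[X]) ^ n).comp (C c * X) := by simp
  rw [this, comp_C_mul_X_coeff, coeff_one_add_X_pow]

lemma kappa (a b : ℕ) :
    (1 - (-1 : ℂ) ^ a) * ((-Complex.I) ^ b + Complex.I ^ b) * (-Complex.I)
      - ((-Complex.I) ^ a - Complex.I ^ a) * (1 + (-1) ^ b)
    = if (a + b) % 4 = 3 then (-8 * Complex.I) * (if Even b then (-1) ^ (b / 2) else 0) else 0 := by
  have ha := Nat.div_add_mod a 4
  have hb := Nat.div_add_mod b 4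
  have ha4 := Nat.mod_lt a (show 4 > 0 by norm_num)
  have hb4 := Nat.mod_lt b (show 4 > 0 by norm_num)
  generalize a / 4 = a' at ha
  generalize b / 4 = b' at hb
  generalize a % 4 = ra at ha ha4
  generalize b % 4 = rb at hb hb4
  have hI2 : Complex.I ^ 2 = -1 := Complex.I_sq
  have hI3 : Complex.I ^ 3 = -Complex.I := by rw [pow_succ, hI2]; ring
  have hI4 : Complex.I ^ 4 = 1 := Complex.I_pow_four
  have hd : ∀ r, (4 * b' + r) / 2 = 2 * b' + r / 2 := by intro r; omega
  have he : ∀ r, Even (4 * b' + r) ↔ Even r := by intro r; rw [Nat.even_iff, Nat.even_iff]; omega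
  have hm : ∀ x y, (4 * a' + x + (4 * b' + y)) % 4 = (x + y) % 4 := by intro x y; omega
  subst ha hb
  simp only [hd, he, hm]
  have hn2 : (-Complex.I) ^ 2 = -1 := by rw [neg_sq, hI2]
  have hn3 : (-Complex.I) ^ 3 = Complex.I := by rw [pow_succ, hn2]; ring
  have hn4 : (-Complex.I) ^ 4 = 1 := by rw [pow_succ, hn3]; linear_combination -hI2
  have h14 : (-1 : ℂ) ^ 4 = 1 := by norm_num
  have h12 : (-1 : ℂ) ^ 2 = 1 := by norm_num
  simp only [pow_add, pow_mul, hI4, hn4, h14, h12, one_pow, one_mul]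
  interval_cases ra <;> interval_cases rb <;>
    simp [hI2, hI3, hn2, hn3, show ¬ Even 1 by decide, show ¬ Even 3 by decide] <;>
    ring_nf
  all_goals try simp

lemma sum_four {R : Type*} [AddCommMonoid R] (f : ℕ → R) (hf : ∀ N, N % 4 ≠ 3 → f N = 0) (J : ℕ) :
    ∑ N ∈ Finset.range (4 * J), f N = ∑ j ∈ Finset.range J, f (4 * j + 3) := by
  induction J with
  | zero => simp
  | succ J ih =>
    rw [show 4 * (J + 1) = 4 * J + 1 + 1 + 1 + 1 by ring]
    rw [Finset.sum_range_succ, Finset.sum_range_succ, Finset.sum_range_succ,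
      Finset.sum_range_succ, ih, Finset.sum_range_succ]
    rw [hf (4 * J) (by omega), hf (4 * J + 1) (by omega), hf (4 * J + 1 + 1) (by omega)]
    simp

open Polynomial in
lemma skolem_series (T r v : ℤ) (n : ℕ) (hv : v ≠ 0)
    (hall : ∀ τ : ℂ, τ ^ 4 = (T : ℂ) ^ 4 + 1 →
      (τ * v + r) * (τ - T) ^ n = (τ * v - r) * (τ + T) ^ n) :
    ∑ j ∈ Finset.range (n + 1), (skG n j : ℚ) * ((T : ℚ) ^ 4 / ((T : ℚ) ^ 4 + 1)) ^ j = 0 ∨ T = 0 := by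
  by_cases hT : T = 0
  · right; exact hT
  left
  obtain ⟨τ, hτ⟩ := IsAlgClosed.exists_pow_nat_eq ((T : ℂ) ^ 4 + 1) (show 0 < 4 by norm_num)
  have hD : (T : ℂ) ^ 4 + 1 ≠ 0 := by
    have : (0 : ℤ) < T ^ 4 + 1 := by positivity
    exact_mod_cast this.ne'
  have hτ0 : τ ≠ 0 := by
    rintro rfl
    apply hD; rw [← hτ]; simp
  have hI2 : Complex.I ^ 2 = -1 := Complex.I_sq
  have e1 := hall τ hτ
  have e2 := hall (Complex.I * τ) (by rw [mul_pow, Complex.I_pow_four, one_mul, hτ])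
  set z : ℂ := T / τ with hz
  have hzτ : (T : ℂ) = z * τ := by rw [hz]; field_simp
  have f1 : (τ * v + r) * (1 - z) ^ n = (τ * v - r) * (1 + z) ^ n := by
    have a1 : (τ - T) = τ * (1 - z) := by rw [hzτ]; ring
    have a2 : (τ + T) = τ * (1 + z) := by rw [hzτ]; ring
    rw [a1, a2, mul_pow, mul_pow] at e1
    apply mul_left_cancel₀ (pow_ne_zero n hτ0)
    linear_combination e1
  have f2 : (Complex.I * τ * v + r) * (1 + Complex.I * z) ^ n
      = (Complex.I * τ * v - r) * (1 - Complex.I * z) ^ n := by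
    have a1 : (Complex.I * τ - T) = (Complex.I * τ) * (1 + Complex.I * z) := by
      rw [hzτ]; linear_combination - z * τ * hI2
    have a2 : (Complex.I * τ + T) = (Complex.I * τ) * (1 - Complex.I * z) := by
      rw [hzτ]; linear_combination z * τ * hI2
    rw [a1, a2, mul_pow (Complex.I * τ), mul_pow (Complex.I * τ)] at e2
    apply mul_left_cancel₀ (pow_ne_zero n (mul_ne_zero Complex.I_ne_zero hτ0))
    linear_combination e2
  set q : ℂ → ℂ[X] := fun c => (1 + C c * X) ^ n with hq
  set K : ℂ[X] := (q 1 - q (-1)) * (q (-Complex.I) + q Complex.I) * C (-Complex.I)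
    - (q (-Complex.I) - q Complex.I) * (q 1 + q (-1)) with hK
  have hK0 : K.eval z = 0 := by
    have hvτ : τ * v ≠ 0 := mul_ne_zero hτ0 (by exact_mod_cast hv)
    apply mul_left_cancel₀ hvτ
    simp only [hK, hq, eval_sub, eval_mul, eval_add, eval_pow, eval_one, eval_C, eval_X]
    rw [show 1 + -1 * z = 1 - z by ring, show 1 + 1 * z = 1 + z by ring,
      show 1 + -Complex.I * z = 1 - Complex.I * z by ring]
    set Ap := (1 + z) ^ n
    set Am := (1 - z) ^ n
    set Bp := (1 - Complex.I * z) ^ n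
    set Bm := (1 + Complex.I * z) ^ n
    linear_combination (Bp + Bm) * Complex.I * f1 - Complex.I * (Ap + Am) * f2
      - τ * v * (Ap + Am) * (Bp - Bm) * hI2
  have hqd : ∀ c, (q c).natDegree ≤ n := by
    intro c
    simp only [hq]
    refine natDegree_pow_le.trans ?_
    have : (1 + C c * X : ℂ[X]).natDegree ≤ 1 := by compute_degree
    nlinarith
  have hKd : K.natDegree < 4 * (n + 1) := by
    have h1 : ((q 1 - q (-1)) * (q (-Complex.I) + q Complex.I) * C (-Complex.I)).natDegree ≤ n + n := by
      refine (natDegree_mul_C_le _ _).trans (natDegree_mul_le.trans (add_le_add ?_ ?_))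
      · exact (natDegree_sub_le _ _).trans (max_le (hqd _) (hqd _))
      · exact (natDegree_add_le _ _).trans (max_le (hqd _) (hqd _))
    have h2 : ((q (-Complex.I) - q Complex.I) * (q 1 + q (-1))).natDegree ≤ n + n := by
      refine (natDegree_mul_le.trans (add_le_add ?_ ?_))
      · exact (natDegree_sub_le _ _).trans (max_le (hqd _) (hqd _))
      · exact (natDegree_add_le _ _).trans (max_le (hqd _) (hqd _))
    have := (natDegree_sub_le _ _).trans (max_le h1 h2)
    rw [← hK] at this
    omega
  have hcoeff : ∀ N, K.coeff N = ∑ x ∈ Finset.HasAntidiagonal.antidiagonal N,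
      (n.choose x.1 : ℂ) * (n.choose x.2) *
      (if N % 4 = 3 then (-8 * Complex.I) * (if Even x.2 then (-1) ^ (x.2 / 2) else 0) else 0) := by
    intro N
    rw [hK, coeff_sub, coeff_mul_C, coeff_mul, coeff_mul, Finset.sum_mul, ← Finset.sum_sub_distrib]
    refine Finset.sum_congr rfl fun x hx => ?_
    rw [Finset.HasAntidiagonal.mem_antidiagonal] at hx
    rw [← hx, ← kappa]
    simp only [hq, coeff_sub, coeff_add, coeff_q, one_pow]
    ring
  have h3 : ∀ j, K.coeff (4 * j + 3) = (-8 * Complex.I) * (skG n j : ℂ) := by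
    intro j
    rw [hcoeff, skG]
    push_cast
    rw [Finset.mul_sum]
    refine Finset.sum_congr rfl fun x hx => ?_
    rw [if_pos (by omega)]
    split_ifs
    · push_cast; ring
    · simp
  have h03 : ∀ N, N % 4 ≠ 3 → K.coeff N = 0 := by
    intro N hN
    rw [hcoeff]
    exact Finset.sum_eq_zero fun x _ => by rw [if_neg hN, mul_zero]
  rw [eval_eq_sum_range' hKd, sum_four _ (fun N hN => by rw [h03 N hN, zero_mul])] at hK0
  have hz4 : z ^ 4 = (T : ℂ) ^ 4 / ((T : ℂ) ^ 4 + 1) := by rw [hz, div_pow, hτ]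
  have hz0 : z ≠ 0 := div_ne_zero (by exact_mod_cast hT) hτ0
  have : (-8 * Complex.I * z ^ 3) * ∑ j ∈ Finset.range (n + 1), (skG n j : ℂ) *
      ((T : ℂ) ^ 4 / ((T : ℂ) ^ 4 + 1)) ^ j = 0 := by
    rw [← hK0, Finset.mul_sum]
    refine Finset.sum_congr rfl fun j _ => ?_
    rw [h3, ← hz4]
    ring
  have hne : (-8 * Complex.I * z ^ 3) ≠ 0 :=
    mul_ne_zero (mul_ne_zero (by norm_num) Complex.I_ne_zero) (pow_ne_zero _ hz0)
  have := (mul_eq_zero.mp this).resolve_left hne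
  exact_mod_cast this

lemma cop_pow (a b c k : ℕ) (hab : Nat.Coprime a b) (h : a * b = c ^ k) :
    (∃ d, a = d ^ k) ∧ ∃ d, b = d ^ k := by
  constructor
  · exact exists_eq_pow_of_mul_eq_pow (Nat.isUnit_iff.mpr hab) h
  · exact exists_eq_pow_of_mul_eq_pow (a := b) (b := a)
      (Nat.isUnit_iff.mpr hab.symm) (by rw [mul_comm]; exact h)

lemma fourth_aux (b a : ℕ) (h : b ^ 4 = 8 * a ^ 4 + 1) : a = 0 := by
  have hb : b % 2 = 1 := by
    by_contra hc
    obtain ⟨k, rfl⟩ : 2 ∣ b := by omega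
    have : (2 * k) ^ 4 = 2 * (8 * k ^ 4) := by ring
    omega
  have h8 : b ^ 2 % 8 = 1 := by
    have : b % 8 = 1 ∨ b % 8 = 3 ∨ b % 8 = 5 ∨ b % 8 = 7 := by omega
    rcases this with h | h | h | h <;> simp [Nat.pow_mod, h]
  obtain ⟨k, hk⟩ : ∃ k, b ^ 2 = 8 * k + 1 := ⟨b ^ 2 / 8, by omega⟩
  have hm : (2 * k) * (4 * k + 1) = a ^ 4 := by
    have : b ^ 4 = (8 * k + 1) ^ 2 := by rw [← hk]; ring
    nlinarith
  obtain ⟨⟨d, hd⟩, _⟩ := cop_pow _ _ _ _ (by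
    have : 4 * k + 1 = 1 + 2 * (2 * k) := by ring
    rw [this]
    simp) hm
  have h2 : b ^ 2 = (2 * d ^ 2) ^ 2 + 1 := by rw [hk]; linarith [hd, show (2 * d ^ 2) ^ 2 = 4 * d ^ 4 by ring]
  have h3 : d = 0 := by
    by_contra hd0
    have hpos : 0 < 2 * d ^ 2 := by positivity
    generalize 2 * d ^ 2 = e at *
    have h5 : e < b := by
      by_contra hc
      push Not at hc
      nlinarith
    nlinarith
  subst h3
  have : k = 0 := by simpa using hd
  subst this
  simpa using hm.symm

lemma two_fourth (x y : ℕ) (h : x ^ 2 = 2 * y ^ 4 + 1) : y = 0 := by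
  have hx : x % 2 = 1 := by
    by_contra hc
    obtain ⟨k, rfl⟩ : 2 ∣ x := by omega
    have : (2 * k) ^ 2 = 2 * (2 * k ^ 2) := by ring
    omega
  obtain ⟨m, rfl⟩ : ∃ m, x = 2 * m + 1 := ⟨x / 2, by omega⟩
  have h1 : 2 * (m * (m + 1)) = y ^ 4 := by nlinarith
  have hy : 2 ∣ y := by
    have : 2 ∣ y ^ 4 := ⟨_, h1.symm⟩
    exact Nat.prime_two.dvd_of_dvd_pow this
  obtain ⟨c, rfl⟩ := hy
  have h2 : m * (m + 1) = 8 * c ^ 4 := by nlinarith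
  have hcop : Nat.Coprime m (m + 1) := by simp
  rcases Nat.even_or_odd m with hm | hm
  · have h8 : 8 ∣ m := by
      have hc : Nat.Coprime 8 (m + 1) := by
        have : Nat.Coprime 2 (m + 1) := by
          rw [Nat.coprime_two_left]; exact hm.add_one
        exact Nat.Coprime.pow_left 3 this
      exact hc.dvd_of_dvd_mul_right ⟨_, h2⟩
    obtain ⟨k, rfl⟩ := h8
    have h3 : k * (8 * k + 1) = c ^ 4 := by nlinarith
    obtain ⟨⟨a, ha⟩, ⟨b, hb⟩⟩ := cop_pow _ _ _ _ (Nat.Coprime.coprime_mul_left hcop) h3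
    have := fourth_aux b a (by rw [← hb, ← ha])
    subst this
    have : k = 0 := by simpa using ha
    subst this
    have h4 : c ^ 4 = 0 := by rw [← h3, Nat.zero_mul]
    have h5 : c = 0 := by simpa using h4
    rw [h5]
  · have h8 : 8 ∣ m + 1 := by
      have hc : Nat.Coprime 8 m := by
        have : Nat.Coprime 2 m := by
          rw [Nat.coprime_two_left]; exact hm
        exact Nat.Coprime.pow_left 3 this
      exact hc.dvd_of_dvd_mul_left ⟨_, h2⟩
    obtain ⟨k, hk⟩ := h8
    have h3 : m * k = c ^ 4 := by rw [hk] at h2; nlinarith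
    rw [hk] at hcop
    obtain ⟨⟨a, ha⟩, _⟩ := cop_pow _ _ _ _ (Nat.Coprime.coprime_mul_left_right hcop) h3
    exfalso
    have h7 : a ^ 4 % 8 = 7 := by omega
    have : a % 8 < 8 := Nat.mod_lt _ (by norm_num)
    rw [Nat.pow_mod] at h7
    interval_cases a % 8 <;> simp at h7

lemma two_fourth_int (x y : ℤ) (h : x ^ 2 = 2 * y ^ 4 + 1) : y = 0 := by
  have := two_fourth x.natAbs y.natAbs (by
    zify
    rw [sq_abs, show |y| ^ 4 = y ^ 4 from (by decide : Even 4).pow_abs y, h])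
  simpa using this

lemma unit_small (T c0 c1 c2 c3 : ℤ) (hT : 2 ≤ T) (d : ℝ) (hd : d ^ 2 = (T : ℝ) ^ 4 + 1) (hd0 : 0 < d)
    (h1 : c0 ^ 2 + (T ^ 4 + 1) * c2 ^ 2 - 2 * (T ^ 4 + 1) * c1 * c3 = 1)
    (h2 : 2 * c0 * c2 - c1 ^ 2 - (T ^ 4 + 1) * c3 ^ 2 = 0)
    (hA : 1 ≤ c0 + c2 * d) (hA2 : c0 + c2 * d < 2 * (T : ℝ) ^ 4 + 1 + 2 * (T : ℝ) ^ 2 * d) :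
    c0 = 1 ∧ c1 = 0 ∧ c2 = 0 ∧ c3 = 0 := by
  have hTr : (2 : ℝ) ≤ T := by exact_mod_cast hT
  set s : ℝ := (T : ℝ) ^ 2 with hs
  have hs4 : (4 : ℝ) ≤ s := by nlinarith
  have hd' : d ^ 2 = s ^ 2 + 1 := by rw [hd, hs]; ring
  have hds : s < d := by nlinarith
  have hds2 : d < s + 1 := by nlinarith
  have h1r : (c0 : ℝ) ^ 2 + (s ^ 2 + 1) * c2 ^ 2 - 2 * (s ^ 2 + 1) * c1 * c3 = 1 := by
    rw [hs, ← pow_mul]; exact_mod_cast h1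
  have h2r : 2 * (c0 : ℝ) * c2 - c1 ^ 2 - (s ^ 2 + 1) * c3 ^ 2 = 0 := by
    rw [hs, ← pow_mul]; exact_mod_cast h2
  have hA2' : c0 + c2 * d < 2 * s ^ 2 + 1 + 2 * s * d := by
    have : s ^ 2 = (T : ℝ) ^ 4 := by rw [hs]; ring
    rw [this]; exact hA2
  have hconj : ((c0 : ℝ) - c2 * d) ^ 2 + d * (c1 - c3 * d) ^ 2 = 1 := by
    rw [← hd'] at h1r h2r
    linear_combination h1r - d * h2r
  have hle : ((c0 : ℝ) - c2 * d) ^ 2 ≤ 1 := by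
    have : 0 ≤ d * ((c1 : ℝ) - c3 * d) ^ 2 := by positivity
    linarith
  obtain ⟨hlo, hhi⟩ := abs_le.mp ((sq_le_one_iff_abs_le_one _).mp hle)
  have hc2 : 0 ≤ c2 := by
    by_contra hc
    have : (c2 : ℝ) ≤ -1 := by exact_mod_cast (by omega : c2 ≤ -1)
    nlinarith
  have hc2r : (0 : ℝ) ≤ c2 := by exact_mod_cast hc2
  have hc2u : c2 ≤ 2 * T ^ 2 := by
    have h : (c2 : ℝ) * d < (2 * s + 1) * d := by nlinarith
    have h' : (c2 : ℝ) < 2 * s + 1 := lt_of_mul_lt_mul_right h hd0.le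
    rw [hs] at h'
    have : c2 < 2 * T ^ 2 + 1 := by exact_mod_cast h'
    omega
  have hc2ur : (c2 : ℝ) ≤ 2 * s := by rw [hs]; exact_mod_cast hc2u
  have hsmall : (c2 : ℝ) * (d - s) < 1 := by
    have : (d - s) * (d + s) = 1 := by linear_combination hd'
    nlinarith
  obtain ⟨e, he⟩ : ∃ e, c0 = c2 * T ^ 2 + e := ⟨c0 - c2 * T ^ 2, by ring⟩
  have her : (c0 : ℝ) = c2 * s + e := by rw [hs]; exact_mod_cast he
  have he0 : 0 ≤ e := by
    by_contra hc
    have hm : (e : ℝ) ≤ -1 := by exact_mod_cast (by omega : e ≤ -1)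
    have h3 : (c2 : ℝ) * (d - s) ≤ 0 := by linarith
    have h4 : (c2 : ℝ) ≤ 0 := by nlinarith
    have h5 : (c2 : ℝ) = 0 := le_antisymm h4 hc2r
    rw [her, h5] at hA
    linarith
  have he2 : e < 2 := by
    have : (e : ℝ) < 2 := by linarith
    exact_mod_cast this
  have hT2 : 4 ≤ T ^ 2 := by nlinarith
  have hDpos : 0 < T ^ 4 + 1 := by positivity
  interval_cases e
  · exfalso
    simp at he
    subst he
    have hdv : (T ^ 4 + 1) ∣ c2 ^ 2 + 1 := by
      refine ⟨2 * c2 ^ 2 - 2 * c1 * c3, ?_⟩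
      linear_combination -h1
    obtain ⟨k, hk⟩ := hdv
    have hk0 : 0 < k := by nlinarith [sq_nonneg c2]
    have hk4 : k < 4 := by
      by_contra hc
      push Not at hc
      nlinarith [mul_le_mul hc2u hc2u hc2 (by positivity)]
    interval_cases k
    · have : c2 ^ 2 = (T ^ 2) ^ 2 := by linear_combination hk
      have hc : c2 = T ^ 2 := by nlinarith
      subst hc
      have : (T ^ 4 + 1) * (2 * T ^ 4 - 1) = (T ^ 4 + 1) * (2 * c1 * c3) := by
        linear_combination h1
      have h5 := mul_left_cancel₀ hDpos.ne' this
      have : 2 * (T ^ 4 - c1 * c3) = 1 := by linear_combination h5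
      omega
    · have := two_fourth_int c2 T (by linear_combination hk)
      omega
    · have h3 : (c2 ^ 2 + 1) % 3 = 0 := by rw [hk]; omega
      have : c2 % 3 = 0 ∨ c2 % 3 = 1 ∨ c2 % 3 = 2 := by omega
      rcases this with h | h | h <;> simp [Int.add_emod, pow_two, Int.mul_emod, h] at h3
  · have hdv : (T ^ 4 + 1) ∣ c2 * (2 * T ^ 2 - c2) := by
      refine ⟨2 * c1 * c3 - 2 * c2 ^ 2, ?_⟩
      subst he
      linear_combination h1
    have h0 : c2 * (2 * T ^ 2 - c2) = 0 := by
      apply Int.eq_zero_of_dvd_of_nonneg_of_lt _ _ hdv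
      · exact mul_nonneg hc2 (by linarith)
      · nlinarith [sq_nonneg (T ^ 2 - c2)]
    rcases mul_eq_zero.mp h0 with h | h
    · subst h
      simp at he
      subst he
      have hc3 : c3 = 0 := by
        by_contra hc
        have : 0 < c3 ^ 2 := by positivity
        nlinarith [sq_nonneg c1]
      subst hc3
      have : c1 ^ 2 = 0 := by linarith
      exact ⟨rfl, by simpa using this, rfl, rfl⟩
    · exfalso
      have hc : c2 = 2 * T ^ 2 := by linarith
      have hcr : (c2 : ℝ) = 2 * s := by rw [hs]; exact_mod_cast hc
      rw [her, hcr] at hA2'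
      push_cast at hA2'
      nlinarith

lemma ep_mul {R : Type*} [CommRing R] (T τ c0 c1 c2 c3 : R) (hτ : τ ^ 4 = T ^ 4 + 1) :
    (c0 * (2 * T ^ 4 + 1) + (T ^ 4 + 1) * (c1 * (-2 * T) + c2 * (2 * T ^ 2) + c3 * (-2 * T ^ 3)))
    + (c0 * (-2 * T ^ 3) + c1 * (2 * T ^ 4 + 1) + (T ^ 4 + 1) * (c2 * (-2 * T) + c3 * (2 * T ^ 2))) * τ
    + (c0 * (2 * T ^ 2) + c1 * (-2 * T ^ 3) + c2 * (2 * T ^ 4 + 1) + (T ^ 4 + 1) * (c3 * (-2 * T))) * τ ^ 2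
    + (c0 * (-2 * T) + c1 * (2 * T ^ 2) + c2 * (-2 * T ^ 3) + c3 * (2 * T ^ 4 + 1)) * τ ^ 3
    = (c0 + c1 * τ + c2 * τ ^ 2 + c3 * τ ^ 3) * ((T - τ) ^ 2 * (T ^ 2 + τ ^ 2)) := by
  have h1 : (T - τ) ^ 2 * (T ^ 2 + τ ^ 2) = 2 * T ^ 4 + 1 - 2 * T ^ 3 * τ + 2 * T ^ 2 * τ ^ 2 - 2 * T * τ ^ 3 := by
    linear_combination hτ
  rw [h1]
  linear_combination (-((c1 * (-2 * T) + c2 * (2 * T ^ 2) + c3 * (-2 * T ^ 3))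
    + τ * (c2 * (-2 * T) + c3 * (2 * T ^ 2)) + τ ^ 2 * (c3 * (-2 * T)))) * hτ

lemma ep_n1 (T c0 c1 c2 c3 : ℤ) :
    (c0 * (2 * T ^ 4 + 1) + (T ^ 4 + 1) * (c1 * (-2 * T) + c2 * (2 * T ^ 2) + c3 * (-2 * T ^ 3))) ^ 2
    + (T ^ 4 + 1) * (c0 * (2 * T ^ 2) + c1 * (-2 * T ^ 3) + c2 * (2 * T ^ 4 + 1) + (T ^ 4 + 1) * (c3 * (-2 * T))) ^ 2
    - 2 * (T ^ 4 + 1) * (c0 * (-2 * T ^ 3) + c1 * (2 * T ^ 4 + 1) + (T ^ 4 + 1) * (c2 * (-2 * T) + c3 * (2 * T ^ 2)))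
      * (c0 * (-2 * T) + c1 * (2 * T ^ 2) + c2 * (-2 * T ^ 3) + c3 * (2 * T ^ 4 + 1))
    = c0 ^ 2 + (T ^ 4 + 1) * c2 ^ 2 - 2 * (T ^ 4 + 1) * c1 * c3 := by ring

lemma ep_n2 (T c0 c1 c2 c3 : ℤ) :
    2 * (c0 * (2 * T ^ 4 + 1) + (T ^ 4 + 1) * (c1 * (-2 * T) + c2 * (2 * T ^ 2) + c3 * (-2 * T ^ 3)))
    * (c0 * (2 * T ^ 2) + c1 * (-2 * T ^ 3) + c2 * (2 * T ^ 4 + 1) + (T ^ 4 + 1) * (c3 * (-2 * T)))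
    - (c0 * (-2 * T ^ 3) + c1 * (2 * T ^ 4 + 1) + (T ^ 4 + 1) * (c2 * (-2 * T) + c3 * (2 * T ^ 2))) ^ 2
    - (T ^ 4 + 1) * (c0 * (-2 * T) + c1 * (2 * T ^ 2) + c2 * (-2 * T ^ 3) + c3 * (2 * T ^ 4 + 1)) ^ 2
    = 2 * c0 * c2 - c1 ^ 2 - (T ^ 4 + 1) * c3 ^ 2 := by ring

set_option maxHeartbeats 1000000 in
lemma unit_pow (T : ℤ) (hT : 2 ≤ T) (σ : ℝ) (hσ : σ ^ 4 = (T : ℝ) ^ 4 + 1) (hσ0 : 0 < σ) (N : ℕ) :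
    ∀ c0 c1 c2 c3 : ℤ,
    c0 ^ 2 + (T ^ 4 + 1) * c2 ^ 2 - 2 * (T ^ 4 + 1) * c1 * c3 = 1 →
    2 * c0 * c2 - c1 ^ 2 - (T ^ 4 + 1) * c3 ^ 2 = 0 →
    1 ≤ c0 + c1 * σ + c2 * σ ^ 2 + c3 * σ ^ 3 →
    c0 + c1 * σ + c2 * σ ^ 2 + c3 * σ ^ 3 < ((T + σ) ^ 2 * (T ^ 2 + σ ^ 2)) ^ N →
    ∃ n : ℕ, ∀ τ : ℂ, τ ^ 4 = (T : ℂ) ^ 4 + 1 →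
      c0 + c1 * τ + c2 * τ ^ 2 + c3 * τ ^ 3 = ((T + τ) ^ 2 * (T ^ 2 + τ ^ 2)) ^ n := by
  have hTr : (2 : ℝ) ≤ T := by exact_mod_cast hT
  set θ : ℝ := (T + σ) ^ 2 * (T ^ 2 + σ ^ 2) with hθ
  set θ' : ℝ := (T - σ) ^ 2 * (T ^ 2 + σ ^ 2) with hθ'
  have hθθ : θ * θ' = 1 := by
    rw [hθ, hθ']
    linear_combination (σ ^ 4 - T ^ 4 + 1) * hσ
  have hθ1 : 1 < θ := by
    have : (T : ℝ) ^ 2 * T ^ 2 ≤ θ := by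
      rw [hθ]; apply mul_le_mul <;> nlinarith
    nlinarith
  induction N with
  | zero =>
    intro c0 c1 c2 c3 _ _ h3 h4
    simp at h4
    linarith
  | succ N ih =>
    intro c0 c1 c2 c3 h1 h2 h3 h4
    set ξ : ℝ := c0 + c1 * σ + c2 * σ ^ 2 + c3 * σ ^ 3 with hξ
    have h1r : (c0 : ℝ) ^ 2 + (T ^ 4 + 1) * c2 ^ 2 - 2 * (T ^ 4 + 1) * c1 * c3 = 1 := by
      exact_mod_cast h1
    have h2r : 2 * (c0 : ℝ) * c2 - c1 ^ 2 - (T ^ 4 + 1) * c3 ^ 2 = 0 := by exact_mod_cast h2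
    by_cases hlt : ξ < θ
    · set ξ' : ℝ := c0 - c1 * σ + c2 * σ ^ 2 - c3 * σ ^ 3 with hξ'
      have hxx : ξ * ξ' = 1 := by
        rw [hξ, hξ']
        rw [← hσ] at h1r h2r
        linear_combination h1r + σ ^ 2 * h2r
      have hsum : (c0 : ℝ) + c2 * σ ^ 2 = (ξ + ξ') / 2 := by rw [hξ, hξ']; ring
      have hsumθ : 2 * (T : ℝ) ^ 4 + 1 + 2 * (T : ℝ) ^ 2 * σ ^ 2 = (θ + θ') / 2 := by
        rw [hθ, hθ']; linear_combination -hσ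
      have hξ'0 : 0 < ξ' := by
        by_contra hc
        push Not at hc
        nlinarith
      have hθ'0 : 0 < θ' := by
        by_contra hc
        push Not at hc
        nlinarith
      have hξ'1 : ξ' ≤ 1 := by nlinarith
      have hθ'1 : θ' < 1 := by nlinarith
      obtain ⟨rfl, rfl, rfl, rfl⟩ := unit_small T c0 c1 c2 c3 hT (σ ^ 2) (by rw [← hσ]; ring)
        (by positivity) h1 h2
        (by rw [hsum]; nlinarith [sq_nonneg (ξ - ξ')])
        (by
          rw [hsum, hsumθ]
          have e : θ + θ' - (ξ + ξ') = (θ - ξ) * (1 - θ' * ξ') := by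
            linear_combination (ξ' * hθθ - θ' * hxx)
          have : θ' * ξ' < 1 := by nlinarith
          have : 0 < (θ - ξ) * (1 - θ' * ξ') := mul_pos (by linarith) (by linarith)
          linarith)
      exact ⟨0, fun τ _ => by simp⟩
    · push Not at hlt
      have hre := ep_mul (T : ℝ) σ c0 c1 c2 c3 hσ
      have hn1 := (ep_n1 T c0 c1 c2 c3).trans h1
      have hn2 := (ep_n2 T c0 c1 c2 c3).trans h2
      have hcx := fun τ : ℂ => ep_mul (T : ℂ) τ c0 c1 c2 c3
      obtain ⟨e0, he0⟩ : ∃ e : ℤ, e = c0 * (2 * T ^ 4 + 1) + (T ^ 4 + 1) * (c1 * (-2 * T) + c2 * (2 * T ^ 2) + c3 * (-2 * T ^ 3)) := ⟨_, rfl⟩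
      obtain ⟨e1, he1⟩ : ∃ e : ℤ, e = c0 * (-2 * T ^ 3) + c1 * (2 * T ^ 4 + 1) + (T ^ 4 + 1) * (c2 * (-2 * T) + c3 * (2 * T ^ 2)) := ⟨_, rfl⟩
      obtain ⟨e2, he2⟩ : ∃ e : ℤ, e = c0 * (2 * T ^ 2) + c1 * (-2 * T ^ 3) + c2 * (2 * T ^ 4 + 1) + (T ^ 4 + 1) * (c3 * (-2 * T)) := ⟨_, rfl⟩
      obtain ⟨e3, he3⟩ : ∃ e : ℤ, e = c0 * (-2 * T) + c1 * (2 * T ^ 2) + c2 * (-2 * T ^ 3) + c3 * (2 * T ^ 4 + 1) := ⟨_, rfl⟩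
      rw [← he0, ← he1, ← he2, ← he3] at hn1 hn2
      have hre' : (e0 : ℝ) + e1 * σ + e2 * σ ^ 2 + e3 * σ ^ 3 = ξ * θ' := by
        rw [he0, he1, he2, he3]
        push_cast
        exact hre
      have hcx' : ∀ τ : ℂ, τ ^ 4 = (T : ℂ) ^ 4 + 1 → (e0 : ℂ) + e1 * τ + e2 * τ ^ 2 + e3 * τ ^ 3
          = (c0 + c1 * τ + c2 * τ ^ 2 + c3 * τ ^ 3) * ((T - τ) ^ 2 * (T ^ 2 + τ ^ 2)) := by
        intro τ hτ
        rw [he0, he1, he2, he3, ← hcx τ hτ]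
        push_cast
        rfl
      clear hre hcx he0 he1 he2 he3
      have hθ'0 : 0 < θ' := by
        by_contra hc
        push Not at hc
        nlinarith
      obtain ⟨n, hn⟩ := ih e0 e1 e2 e3 hn1 hn2
        (by
          rw [hre']
          nlinarith)
        (by
          rw [hre']
          calc ξ * θ' < θ ^ (N + 1) * θ' := mul_lt_mul_of_pos_right h4 hθ'0
            _ = θ ^ N * (θ * θ') := by ring
            _ = θ ^ N := by rw [hθθ, mul_one])
      refine ⟨n + 1, fun τ hτ => ?_⟩
      have hone : ((T : ℂ) - τ) ^ 2 * (T ^ 2 + τ ^ 2) * ((T + τ) ^ 2 * (T ^ 2 + τ ^ 2)) = 1 := by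
        linear_combination (τ ^ 4 - T ^ 4 + 1) * hτ
      rw [pow_succ _ n, ← hn τ hτ, hcx' τ hτ, mul_assoc, hone, mul_one]

lemma thue_main (p : ℕ) [hp : Fact p.Prime] (T : ℤ)
    (hpT : (3 ≤ p ∧ (p : ℤ) ∣ T) ∨ (p = 2 ∧ (4 : ℤ) ∣ T)) (hT : 2 ≤ T) (r v : ℤ) (hr : 0 < r) (hv : 0 < v)
    (h : r ^ 4 + 1 = (T ^ 4 + 1) * v ^ 4) : v = 1 := by
  have hTr : (2 : ℝ) ≤ T := by exact_mod_cast hT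
  obtain ⟨σ, hσ0, hσ⟩ : ∃ σ : ℝ, 0 < σ ∧ σ ^ 4 = (T : ℝ) ^ 4 + 1 := by
    refine ⟨((T : ℝ) ^ 4 + 1) ^ ((1 : ℝ) / 4), by positivity, ?_⟩
    rw [← Real.rpow_natCast, ← Real.rpow_mul (by positivity)]
    norm_num
  have hθ1 : 1 < (T + σ) ^ 2 * ((T : ℝ) ^ 2 + σ ^ 2) := by
    have : (T : ℝ) ^ 2 * T ^ 2 ≤ (T + σ) ^ 2 * ((T : ℝ) ^ 2 + σ ^ 2) := by
      apply mul_le_mul <;> nlinarith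
    nlinarith
  set ξ : ℝ := ((2 * r ^ 4 + 1 : ℤ) : ℝ) + ((2 * r ^ 3 * v : ℤ) : ℝ) * σ
    + ((2 * r ^ 2 * v ^ 2 : ℤ) : ℝ) * σ ^ 2 + ((2 * r * v ^ 3 : ℤ) : ℝ) * σ ^ 3 with hξ
  obtain ⟨N, hN⟩ := pow_unbounded_of_one_lt ξ hθ1
  have hrr : (0 : ℝ) < r := by exact_mod_cast hr
  have hvr : (0 : ℝ) < v := by exact_mod_cast hv
  obtain ⟨n, hn⟩ := unit_pow T hT σ hσ hσ0 N _ _ _ _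
    (by linear_combination -4 * r ^ 4 * h * (-1)) (by linear_combination 4 * r ^ 2 * v ^ 2 * h)
    (by
      push_cast
      have : (0 : ℝ) < 2 * r ^ 4 + 2 * r ^ 3 * v * σ + 2 * r ^ 2 * v ^ 2 * σ ^ 2 + 2 * r * v ^ 3 * σ ^ 3 := by
        positivity
      linarith) hN
  have hC : (r : ℂ) ^ 4 + 1 = ((T : ℂ) ^ 4 + 1) * v ^ 4 := by exact_mod_cast h
  have hall : ∀ τ : ℂ, τ ^ 4 = (T : ℂ) ^ 4 + 1 →
      (τ * v + r) * (τ - T) ^ n = (τ * v - r) * (τ + T) ^ n := by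
    intro τ hτ
    have a1 : (τ + T) = ((T + τ) ^ 2 * (T ^ 2 + τ ^ 2)) * (τ - T) := by
      linear_combination -(T + τ) * hτ
    have a2 : τ * v + r = (τ * v - r) * ((T + τ) ^ 2 * (T ^ 2 + τ ^ 2)) ^ n := by
      rw [← hn τ hτ]
      push_cast
      rw [← hτ] at hC
      linear_combination 2 * r * hC
    have a3 : (τ + T) ^ n = ((T + τ) ^ 2 * (T ^ 2 + τ ^ 2)) ^ n * (τ - T) ^ n := by
      rw [← mul_pow, ← a1]
    rw [a3]
    linear_combination (τ - T) ^ n * a2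
  rcases skolem_series T r v n hv.ne' hall with hs | h0
  · have hM := skolem_padic p T hpT n n hs
    obtain ⟨τ, hτ⟩ := IsAlgClosed.exists_pow_nat_eq ((T : ℂ) ^ 4 + 1) (show 0 < 4 by norm_num)
    have hD : (T : ℂ) ^ 4 + 1 ≠ 0 := by
      have : (0 : ℤ) < T ^ 4 + 1 := by positivity
      exact_mod_cast this.ne'
    have hτ0 : τ ≠ 0 := by
      rintro rfl
      apply hD; rw [← hτ]; simp
    have hnn : n = 0 ∨ n = 1 := by
      rcases mul_eq_zero.mp hM with h | h
      · left; exact_mod_cast h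
      · right
        have : (n : ℤ) ^ 2 = 1 := by linarith
        have : n ^ 2 = 1 := by exact_mod_cast this
        simpa using this
    have h5 := hall τ hτ
    rcases hnn with rfl | rfl
    · exfalso
      simp at h5
      have : (2 : ℂ) * r = 0 := by linear_combination h5
      have : (2 : ℤ) * r = 0 := by exact_mod_cast this
      omega
    · have : (2 * τ) * r = (2 * τ) * (v * T) := by linear_combination h5
      have h6 := mul_left_cancel₀ (mul_ne_zero two_ne_zero hτ0) this
      have h7 : r = v * T := by exact_mod_cast h6
      rw [h7] at h
      have h8 : v ^ 4 = 1 := by linear_combination -h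
      by_contra hc
      have : 2 ≤ v := by omega
      have : (2 : ℤ) ^ 4 ≤ v ^ 4 := pow_le_pow_left₀ (by norm_num) this 4
      omega
  · omega

def vr (s : ℤ) : ℕ → ℤ × ℤ
  | 0 => (0, 1)
  | n + 1 => (s * (vr s n).1 + (vr s n).2, (s ^ 2 + 1) * (vr s n).1 + s * (vr s n).2)

lemma vr_add (s : ℤ) (m n : ℕ) :
    (vr s (m + n)).1 = (vr s m).1 * (vr s n).2 + (vr s m).2 * (vr s n).1 ∧
    (vr s (m + n)).2 = (vr s m).2 * (vr s n).2 + (s ^ 2 + 1) * ((vr s m).1 * (vr s n).1) := by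
  induction n with
  | zero => simp [vr]
  | succ n ih =>
    obtain ⟨h1, h2⟩ := ih
    rw [← add_assoc]
    simp only [vr]
    rw [h1, h2]
    constructor <;> ring

lemma vr_norm (s : ℤ) (n : ℕ) : (vr s n).2 ^ 2 - (s ^ 2 + 1) * (vr s n).1 ^ 2 = (-1) ^ n := by
  induction n with
  | zero => simp [vr]
  | succ n ih =>
    simp only [vr]
    rw [pow_succ (-1) n, ← ih]
    ring

lemma vr_even (s : ℤ) (j : ℕ) : (∃ a, (vr s (2 * j)).1 = 2 * s * a) ∧ ∃ b, (vr s (2 * j)).2 = 2 * b + 1 := by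
  induction j with
  | zero => exact ⟨⟨0, by simp [vr]⟩, 0, by simp [vr]⟩
  | succ j ih =>
    obtain ⟨⟨a, ha⟩, b, hb⟩ := ih
    rw [show 2 * (j + 1) = 2 * j + 1 + 1 by ring]
    simp only [vr]
    rw [ha, hb]
    exact ⟨⟨2 * s ^ 2 * a + 2 * s * b * 0 + a + s * (2 * b + 1) * 0 + (2 * b + 1), by ring⟩,
      ⟨(s ^ 2 + 1) * (s * s * a) + s * ((s ^ 2 + 1) * (s * a)) + (s ^ 2 + 1) * b + s ^ 2 * b + s ^ 2, by ring⟩⟩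

lemma vr_odd (s : ℤ) (j : ℕ) : (∃ a, (vr s (2 * j + 1)).1 = 2 * a + 1) ∧
    ∃ b, (vr s (2 * j + 1)).2 = s * (2 * b + 1) := by
  obtain ⟨⟨a, ha⟩, b, hb⟩ := vr_even s j
  simp only [vr]
  rw [ha, hb]
  exact ⟨⟨s ^ 2 * a + b, by ring⟩, ⟨(s ^ 2 + 1) * a + b, by ring⟩⟩

lemma vr_pos (s : ℤ) (hs : 1 ≤ s) (n : ℕ) : (n : ℤ) ≤ (vr s n).1 ∧ 1 ≤ (vr s n).2 := by
  induction n with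
  | zero => simp [vr]
  | succ n ih =>
    obtain ⟨h1, h2⟩ := ih
    simp only [vr]
    push_cast
    have : (0 : ℤ) ≤ n := by positivity
    constructor <;> nlinarith

lemma vr_coprime (s : ℤ) (n : ℕ) : IsCoprime (vr s n).1 (vr s n).2 := by
  have h := vr_norm s n
  rcases neg_one_pow_eq_or ℤ n with h1 | h1 <;> rw [h1] at h
  · exact ⟨-(s ^ 2 + 1) * (vr s n).1, (vr s n).2, by linear_combination h⟩
  · exact ⟨(s ^ 2 + 1) * (vr s n).1, -(vr s n).2, by linear_combination -h⟩

def Sq2 (x : ℤ) : Prop := ∃ m : ℤ, x = m ^ 2 ∨ x = 2 * m ^ 2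

lemma cop_sq (a b c : ℤ) (hab : IsCoprime a b) (ha : 0 ≤ a) (h : a * b = c ^ 2) : ∃ d, a = d ^ 2 := by
  obtain ⟨d, hd | hd⟩ := Int.sq_of_isCoprime hab h
  · exact ⟨d, hd⟩
  · have : d = 0 := by nlinarith
    exact ⟨0, by rw [hd, this]; simp⟩

lemma sq2_split (a b : ℤ) (hab : IsCoprime a b) (ha : 0 ≤ a) (hb : 0 ≤ b) (h : Sq2 (2 * (a * b))) :
    ((∃ d, a = d ^ 2) ∧ ∃ e, b = e ^ 2) ∨ ((∃ d, a = 2 * d ^ 2) ∧ ∃ e, b = e ^ 2) ∨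
    ((∃ d, a = d ^ 2) ∧ ∃ e, b = 2 * e ^ 2) := by
  obtain ⟨m, hm | hm⟩ := h
  · have h2 : (2 : ℤ) ∣ m := Int.prime_two.dvd_of_dvd_pow ⟨_, hm.symm⟩
    obtain ⟨g, rfl⟩ := h2
    have h3 : a * b = 2 * g ^ 2 := by linarith
    have h4 : (2 : ℤ) ∣ a * b := ⟨_, h3⟩
    rcases Int.prime_two.dvd_or_dvd h4 with ⟨c, rfl⟩ | ⟨c, rfl⟩
    · right; left
      have hc : IsCoprime c b := hab.of_mul_left_right
      have h5 : c * b = g ^ 2 := by linarith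
      obtain ⟨d, hd⟩ := cop_sq c b g hc (by linarith) h5
      obtain ⟨e, he⟩ := cop_sq b c g hc.symm hb (by linarith)
      exact ⟨⟨d, by rw [hd]⟩, e, he⟩
    · right; right
      have hc : IsCoprime a c := hab.of_mul_right_right
      have h5 : a * c = g ^ 2 := by linarith
      obtain ⟨d, hd⟩ := cop_sq a c g hc ha h5
      obtain ⟨e, he⟩ := cop_sq c a g hc.symm (by linarith) (by linarith)
      exact ⟨⟨d, hd⟩, e, by rw [he]⟩
  · left
    have h5 : a * b = m ^ 2 := by linarith
    exact ⟨cop_sq a b m hab ha h5, cop_sq b a m hab.symm hb (by linarith)⟩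

lemma odd_no (N : ℕ) : ∀ T b g : ℤ, T.natAbs ≤ N → T ≠ 0 → T ^ 2 * (2 * b + 1) = 2 * g ^ 2 → False := by
  induction N with
  | zero => intro T b g h1 h2; omega
  | succ N ih =>
    intro T b g h1 h2 h3
    have h4 : (2 : ℤ) ∣ T ^ 2 * (2 * b + 1) := ⟨_, h3⟩
    rcases Int.prime_two.dvd_or_dvd h4 with h | h
    · obtain ⟨t, rfl⟩ := Int.prime_two.dvd_of_dvd_pow h
      have h5 : 2 * (t ^ 2 * (2 * b + 1)) = g ^ 2 := by linarith
      obtain ⟨k, rfl⟩ := Int.prime_two.dvd_of_dvd_pow (show (2 : ℤ) ∣ g ^ 2 from ⟨_, h5.symm⟩)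
      exact ih t b k (by omega) (by omega) (by linarith)
    · omega

lemma vr_double (s : ℤ) (k : ℕ) : (vr s (2 * k)).1 = 2 * ((vr s k).1 * (vr s k).2) ∧
    (vr s (2 * k)).2 = 2 * (vr s k).2 ^ 2 - (-1) ^ k := by
  rw [two_mul k, (vr_add s k k).1, (vr_add s k k).2, ← vr_norm s k]
  constructor <;> ring

lemma vr_split (T : ℤ) (hT : 2 ≤ T) (k : ℕ) (h : Sq2 (vr (T ^ 2) (2 * k)).1) :
    (∃ e, (vr (T ^ 2) k).2 = e ^ 2) ∧ Sq2 (vr (T ^ 2) k).1 := by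
  rw [(vr_double _ k).1] at h
  have hp := vr_pos (T ^ 2) (by nlinarith) k
  rcases sq2_split _ _ (vr_coprime _ k) (by linarith) (by linarith) h with
    ⟨⟨d, hd⟩, h⟩ | ⟨⟨d, hd⟩, h⟩ | ⟨_, e, he⟩
  · exact ⟨h, d, Or.inl hd⟩
  · exact ⟨h, d, Or.inr hd⟩
  · exfalso
    rcases Nat.even_or_odd' k with ⟨j, rfl | rfl⟩
    · obtain ⟨b, hb⟩ := (vr_even (T ^ 2) j).2
      omega
    · obtain ⟨b, hb⟩ := (vr_odd (T ^ 2) j).2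
      exact odd_no _ T b e le_rfl (by omega) (by rw [← hb, he])

lemma vr_even_no (T : ℤ) (hT : 2 ≤ T) (k : ℕ) : 0 < k → (∃ e, (vr (T ^ 2) (2 * k)).2 = e ^ 2) →
    Sq2 (vr (T ^ 2) (2 * k)).1 → False := by
  induction k using Nat.strong_induction_on with
  | _ k ih =>
    intro hk ⟨r, hr⟩ h
    obtain ⟨⟨e, he⟩, hV⟩ := vr_split T hT k h
    rcases Nat.even_or_odd' k with ⟨j, hj | hj⟩
    · subst hj
      exact ih j (by omega) (by omega) ⟨e, he⟩ hV
    · have h1 := (vr_double (T ^ 2) k).2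
      rw [hr, he, Odd.neg_one_pow ⟨j, hj⟩] at h1
      have h2 := two_fourth_int r e (by linarith [show (e ^ 2) ^ 2 = e ^ 4 by ring])
      have hp := vr_pos (T ^ 2) (by nlinarith) k
      rw [he, h2] at hp
      simp at hp

lemma thue_main' (T : ℤ) (hT : 12 ≤ T) (r v : ℤ) (hr : 0 < r) (hv : 0 < v)
    (h : r ^ 4 + 1 = (T ^ 4 + 1) * v ^ 4) : v = 1 := by
  rcases Nat.eq_two_pow_or_exists_odd_prime_and_dvd T.natAbs with ⟨k, hk⟩ | ⟨p, hp, hd, ho⟩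
  · have : Fact (Nat.Prime 2) := ⟨Nat.prime_two⟩
    refine thue_main 2 T (Or.inr ⟨rfl, ?_⟩) (by omega) r v hr hv h
    have h2 : 2 ≤ k := by
      by_contra hc
      have : k = 0 ∨ k = 1 := by omega
      rcases this with rfl | rfl <;> omega
    have : 2 ^ 2 ∣ T.natAbs := by rw [hk]; exact pow_dvd_pow 2 h2
    omega
  · have : Fact p.Prime := ⟨hp⟩
    refine thue_main p T (Or.inl ⟨?_, Int.natCast_dvd.mpr hd⟩) (by omega) r v hr hv h
    have := hp.two_le
    obtain ⟨m, rfl⟩ := ho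
    omega

lemma vr_double_sq (T : ℤ) (hT : 12 ≤ T) (k : ℕ) (hk : 0 < k) (h : Sq2 (vr (T ^ 2) (2 * k)).1) : k = 1 := by
  obtain ⟨⟨r, hr⟩, v, hV⟩ := vr_split T (by omega) k h
  rcases Nat.even_or_odd' k with ⟨j, hj | hj⟩
  · subst hj
    exact (vr_even_no T (by omega) j (by omega) ⟨r, hr⟩ ⟨v, hV⟩).elim
  · have hp := vr_pos (T ^ 2) (by nlinarith) k
    have ho := (vr_odd (T ^ 2) j).1
    have hn := vr_norm (T ^ 2) k
    rw [Odd.neg_one_pow ⟨j, hj⟩] at hn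
    rw [← hj] at ho
    obtain ⟨a, ha⟩ := ho
    have hV' : (vr (T ^ 2) k).1 = v ^ 2 := by
      rcases hV with h | h
      · exact h
      · omega
    rw [hr, hV'] at hn hp
    have hv0 : v ≠ 0 := by
      rintro rfl
      have : (0 : ℤ) < k := by exact_mod_cast hk
      linarith [hp.1]
    have hr0 : r ≠ 0 := by
      rintro rfl
      linarith [hp.2]
    have h1 := thue_main' T hT |r| |v| (abs_pos.mpr hr0) (abs_pos.mpr hv0) (by
      rw [(by decide : Even 4).pow_abs r, (by decide : Even 4).pow_abs v]
      linear_combination hn)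
    have h2 : v ^ 2 = 1 := by rw [← sq_abs, h1]; norm_num
    have := hp.1
    rw [h2] at this
    have : k ≤ 1 := by exact_mod_cast this
    omega

lemma vr_claim (T : ℤ) (hT : 12 ≤ T) (n : ℕ) (h0 : Sq2 (vr (T ^ 2) n).1) (h1 : Sq2 (vr (T ^ 2) (n + 1)).1) :
    n = 0 ∨ n = 1 := by
  rcases Nat.even_or_odd' n with ⟨k, rfl | rfl⟩
  · by_cases hk : k = 0
    · left; omega
    · exfalso
      have := vr_double_sq T hT k (by omega) h0
      subst this
      obtain ⟨m, hm⟩ := h1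
      simp [vr] at hm
      have hT2 : 1 ≤ T ^ 2 := by nlinarith
      rcases hm with hm | hm
      · have e : (2 * T ^ 2) ^ 2 + 1 = |m| ^ 2 := by rw [sq_abs, ← hm]; ring
        have hm0 := abs_nonneg m
        have : 2 * T ^ 2 < |m| := by nlinarith
        nlinarith
      · ring_nf at hm
        omega
  · right
    have := vr_double_sq T hT (k + 1) (by omega) h1
    omega

lemma vr_rec (s : ℤ) (n : ℕ) : (vr s (n + 2)).1 = 2 * s * (vr s (n + 1)).1 + (vr s n).1 := by
  simp only [vr]
  ring

lemma gn (z : GaussianInt) : z.norm = z.re ^ 2 + z.im ^ 2 := by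
  rw [Zsqrtd.norm_def]; ring

lemma gn_nonneg (z : GaussianInt) : 0 ≤ z.norm := by
  rw [gn]; positivity

lemma gn_add (a b : GaussianInt) : (a + b).norm ≤ 2 * (a.norm + b.norm) := by
  simp only [gn, Zsqrtd.re_add, Zsqrtd.im_add]
  nlinarith [sq_nonneg (a.re - b.re), sq_nonneg (a.im - b.im)]

lemma gn_sub (a b : GaussianInt) : (a - b).norm ≤ 2 * (a.norm + b.norm) := by
  simp only [gn, Zsqrtd.re_sub, Zsqrtd.im_sub]
  nlinarith [sq_nonneg (a.re + b.re), sq_nonneg (a.im + b.im)]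

lemma gn_int (x : ℤ) : (x : GaussianInt).norm = x ^ 2 := by
  simp [gn]

lemma gi_sq : (Zsqrtd.sqrtd : GaussianInt) * Zsqrtd.sqrtd = -1 := by
  ext <;> simp

lemma gi_norm : (Zsqrtd.sqrtd : GaussianInt).norm = 1 := by
  simp [gn]

lemma g_desc (s : ℤ) (hs : 2 ≤ s) (N : ℕ) : ∀ X Y μ : GaussianInt, μ.norm = 1 → Y.norm ≤ X.norm →
    Y.norm < N → X ^ 2 - 2 * Zsqrtd.sqrtd * (s : GaussianInt) * X * Y + Y ^ 2 = μ →
    ∃ (n : ℕ) (ε : GaussianInt), ε.norm = 1 ∧ X = ε * (((vr s (n + 1)).1 : ℤ) : GaussianInt) ∧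
      Y = (-Zsqrtd.sqrtd * ε : GaussianInt) * (((vr s n).1 : ℤ) : GaussianInt) := by
  induction N with
  | zero =>
    intro X Y μ _ _ h
    have := gn_nonneg Y
    push_cast at h
    linarith
  | succ N ih =>
    intro X Y μ hμ hle hN h
    by_cases hY : Y = 0
    · subst hY
      refine ⟨0, X, ?_, by simp [vr], by simp [vr]⟩
      have h1 : X * X = μ := by rw [← h]; ring
      have h2 : X.norm * X.norm = 1 := by rw [← Zsqrtd.norm_mul, h1, hμ]
      have := gn_nonneg X
      nlinarith
    · obtain ⟨Z, hZ⟩ : ∃ Z, Z = 2 * Zsqrtd.sqrtd * (s : GaussianInt) * Y - X := ⟨_, rfl⟩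
      have hXZ : X * Z = Y * Y - μ := by rw [hZ, ← h]; ring
      have hsum : ((2 * s : ℤ) : GaussianInt) * (Zsqrtd.sqrtd * Y) = X + Z := by
        rw [hZ]; push_cast; ring
      have n1 : X.norm * Z.norm ≤ 2 * (Y.norm * Y.norm + 1) := by
        have := gn_sub (Y * Y) μ
        rw [hμ, ← hXZ, Zsqrtd.norm_mul, Zsqrtd.norm_mul] at this
        exact this
      have n2 : (2 * s) ^ 2 * Y.norm ≤ 2 * (X.norm + Z.norm) := by
        have := gn_add X Z
        rw [← hsum, Zsqrtd.norm_mul, Zsqrtd.norm_mul, gi_norm, gn_int, one_mul] at this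
        exact this
      have hy1 : 1 ≤ Y.norm := by
        have h0 := gn_nonneg Y
        have h1 : Y.norm ≠ 0 := by
          intro h0
          rw [gn] at h0
          apply hY
          ext
          · simp; nlinarith [sq_nonneg Y.re, sq_nonneg Y.im]
          · simp; nlinarith [sq_nonneg Y.re, sq_nonneg Y.im]
        omega
      have hzy : Z.norm < Y.norm := by
        by_contra hc
        push Not at hc
        generalize Z.norm = z at *
        generalize Y.norm = y at *
        generalize X.norm = x at *
        have a1 : 0 ≤ (x - y) * (z - y) := mul_nonneg (by linarith) (by linarith)
        have a3 : 16 * y ≤ (2 * s) ^ 2 * y := mul_le_mul_of_nonneg_right (by nlinarith) (by linarith)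
        have a2 : 8 * y ≤ x + z := by linarith
        nlinarith
      obtain ⟨n, ε, he, h1, h2⟩ := ih Y Z μ hμ hzy.le (by push_cast at hN; linarith) (by
        rw [← h, hZ]; ring)
      refine ⟨n + 1, Zsqrtd.sqrtd * ε, by rw [Zsqrtd.norm_mul, gi_norm, he, one_mul], ?_, ?_⟩
      · rw [vr_rec]
        have : X = 2 * Zsqrtd.sqrtd * (s : GaussianInt) * Y - Z := by rw [hZ]; ring
        rw [this, h1, h2]
        push_cast
        ring
      · rw [h1]
        linear_combination (ε * (((vr s (n + 1)).1 : ℤ) : GaussianInt)) * gi_sq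

lemma g_sq (P ε : GaussianInt) (x : ℤ) (hx : 0 ≤ x) (hε : ε.norm = 1) (h : P ^ 2 = ε * (x : ℤ)) :
    P.norm = x ∧ (P.re * P.im = 0 ∨ P.re ^ 2 = P.im ^ 2) := by
  constructor
  · have h1 : P.norm * P.norm = x * x := by
      rw [← Zsqrtd.norm_mul, ← pow_two, h, Zsqrtd.norm_mul, hε, gn_int]; ring
    have := gn_nonneg P
    nlinarith
  · have hr := congrArg Zsqrtd.re h
    have hi := congrArg Zsqrtd.im h
    simp [pow_two] at hr hi
    have he : ε.re * ε.im = 0 := by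
      rw [gn] at hε
      by_contra hc
      have h1 : ε.re ≠ 0 := left_ne_zero_of_mul hc
      have h2 : ε.im ≠ 0 := right_ne_zero_of_mul hc
      have : 0 < ε.re ^ 2 := by positivity
      have : 0 < ε.im ^ 2 := by positivity
      omega
    have h3 : (P.re * P.im) * (P.re ^ 2 - P.im ^ 2) = 0 := by
      have : 2 * ((P.re * P.im) * (P.re ^ 2 - P.im ^ 2)) = 0 := by
        calc _ = (P.re * P.re + -(P.im * P.im)) * (P.re * P.im + P.im * P.re) := by ring
          _ = (ε.re * x) * (ε.im * x) := by rw [hr, hi]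
          _ = (ε.re * ε.im) * x ^ 2 := by ring
          _ = 0 := by rw [he, zero_mul]
      linarith
    rcases mul_eq_zero.mp h3 with h | h
    · exact Or.inl h
    · right; linarith

lemma g_sq2 (P ε : GaussianInt) (x : ℤ) (hx : 0 ≤ x) (hε : ε.norm = 1) (h : P ^ 2 = ε * (x : ℤ)) : Sq2 x := by
  obtain ⟨h1, h2⟩ := g_sq P ε x hx hε h
  rw [gn] at h1
  rcases h2 with h2 | h2
  · rcases mul_eq_zero.mp h2 with h | h
    · exact ⟨P.im, Or.inl (by rw [← h1, h]; ring)⟩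
    · exact ⟨P.re, Or.inl (by rw [← h1, h]; ring)⟩
  · exact ⟨P.re, Or.inr (by rw [← h1, ← h2]; ring)⟩

lemma g_core (T : ℤ) (hT : 12 ≤ T) (P Q : GaussianInt) (hle : (Q ^ 2).norm ≤ (P ^ 2).norm)
    (h : (P ^ 4 - 2 * Zsqrtd.sqrtd * (T : GaussianInt) ^ 2 * P ^ 2 * Q ^ 2 + Q ^ 4).norm = 1) :
    (P.norm = 1 ∧ Q = 0) ∨ (Q.norm = 1 ∧ P.re ^ 2 = T ^ 2 ∧ P.im ^ 2 = T ^ 2) := by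
  have hT2 : 2 ≤ T ^ 2 := by nlinarith
  obtain ⟨n, ε, he, hP, hQ⟩ := g_desc (T ^ 2) hT2 ((Q ^ 2).norm.toNat + 1) (P ^ 2) (Q ^ 2) _ h hle
    (by push_cast; omega) (by push_cast; ring)
  have he' : (-Zsqrtd.sqrtd * ε).norm = 1 := by
    rw [Zsqrtd.norm_mul, Zsqrtd.norm_neg, gi_norm, he, one_mul]
  have hp : ∀ k, 0 ≤ (vr (T ^ 2) k).1 := fun k =>
    le_trans (by positivity) (vr_pos (T ^ 2) (by linarith) k).1
  rcases vr_claim T hT n (g_sq2 Q _ _ (hp n) he' hQ) (g_sq2 P _ _ (hp _) he hP) with rfl | rfl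
  · left
    have h1 := (g_sq P _ _ (hp _) he hP).1
    simp [vr] at h1 hQ
    exact ⟨h1, hQ⟩
  · right
    have h1 := (g_sq Q _ _ (hp _) he' hQ).1
    obtain ⟨h2, h3⟩ := g_sq P _ _ (hp _) he hP
    simp [vr] at h1 h2
    rw [gn] at h2
    refine ⟨h1, ?_⟩
    rcases h3 with h3 | h3
    · exfalso
      have hne : ∀ a : ℤ, a ^ 2 = 2 * T ^ 2 → False := by
        intro a ha
        refine odd_no _ a 0 T le_rfl ?_ (by linarith)
        rintro rfl
        nlinarith
      rcases mul_eq_zero.mp h3 with h4 | h4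
      · exact hne P.im (by rw [h4] at h2; linarith)
      · exact hne P.re (by rw [h4] at h2; linarith)
    · constructor <;> linarith

lemma g_unit (P : GaussianInt) (h : P.norm = 1) : ∃ u : GaussianIntˣ, P = u := by
  have : IsUnit P := Zsqrtd.norm_eq_one_iff.mp (by rw [h]; rfl)
  obtain ⟨u, hu⟩ := this
  exact ⟨u, hu.symm⟩

lemma g_assoc (T : ℤ) (P : GaussianInt) (h1 : P.re ^ 2 = T ^ 2) (h2 : P.im ^ 2 = T ^ 2) :
    ∃ u : GaussianIntˣ, P = (u : GaussianInt) * ((1 + Zsqrtd.sqrtd) * (T : GaussianInt)) := by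
  suffices ∃ u : GaussianInt, u.norm = 1 ∧ P = u * ((1 + Zsqrtd.sqrtd) * (T : GaussianInt)) by
    obtain ⟨u, hu, h⟩ := this
    obtain ⟨w, rfl⟩ := g_unit u hu
    exact ⟨w, h⟩
  rcases sq_eq_sq_iff_eq_or_eq_neg.mp h1 with a | a <;>
    rcases sq_eq_sq_iff_eq_or_eq_neg.mp h2 with b | b
  · exact ⟨1, by simp [gn], by ext <;> simp [a, b]⟩
  · exact ⟨-Zsqrtd.sqrtd, by simp [gn], by ext <;> simp [a, b]⟩
  · exact ⟨Zsqrtd.sqrtd, by simp [gn], by ext <;> simp [a, b]⟩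
  · exact ⟨-1, by simp [gn], by ext <;> simp [a, b]⟩

/-- For an integer `T` with `|T| > 11` and Gaussian integers `P, Q`,
if `P⁴ − 2iT²P²Q² + Q⁴` is a unit of `ℤ[i]`, then up to unit factors `(P, Q)` is
one of `(1, 0)`, `(0, 1)`, `(1, (1+i)T)`, `((1+i)T, 1)`. -/
theorem stmt_7 (T : ℤ) (hT : 11 < |T|) (P Q : GaussianInt)
    (h : IsUnit (P ^ 4 - 2 * Zsqrtd.sqrtd * (T : GaussianInt) ^ 2 * P ^ 2 * Q ^ 2 + Q ^ 4)) :
    ∃ (ε δ : GaussianIntˣ) (p q : GaussianInt),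
      ((p, q) ∈ ([(1, 0), (0, 1),
        (1, (1 + Zsqrtd.sqrtd) * (T : GaussianInt)),
        ((1 + Zsqrtd.sqrtd) * (T : GaussianInt), 1)] : List (GaussianInt × GaussianInt))) ∧
      P = (ε : GaussianInt) * p ∧ Q = (δ : GaussianInt) * q := by
  have hn : (P ^ 4 - 2 * Zsqrtd.sqrtd * (T : GaussianInt) ^ 2 * P ^ 2 * Q ^ 2 + Q ^ 4).norm = 1 := by
    have h1 := Zsqrtd.norm_eq_one_iff.mpr h
    have h2 := gn_nonneg (P ^ 4 - 2 * Zsqrtd.sqrtd * (T : GaussianInt) ^ 2 * P ^ 2 * Q ^ 2 + Q ^ 4)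
    omega
  have hTT : ((|T| : ℤ) : GaussianInt) ^ 2 = (T : GaussianInt) ^ 2 := by
    have : |T| ^ 2 = T ^ 2 := sq_abs T
    exact_mod_cast congrArg (Int.cast : ℤ → GaussianInt) this
  rcases le_total (Q ^ 2).norm (P ^ 2).norm with hle | hle
  · rcases g_core |T| (by omega) P Q hle (by rw [hTT]; exact hn) with ⟨h1, h2⟩ | ⟨h1, h2, h3⟩
    · obtain ⟨u, hu⟩ := g_unit P h1
      exact ⟨u, 1, 1, 0, by simp, by rw [mul_one]; exact hu, by rw [h2]; simp⟩
    · obtain ⟨u, hu⟩ := g_unit Q h1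
      rw [sq_abs] at h2 h3
      obtain ⟨w, hw⟩ := g_assoc T P h2 h3
      exact ⟨w, u, (1 + Zsqrtd.sqrtd) * (T : GaussianInt), 1, by simp, hw, by rw [mul_one]; exact hu⟩
  · rcases g_core |T| (by omega) Q P hle (by
      rw [hTT]; exact (congrArg Zsqrtd.norm (by ring)).trans hn) with ⟨h1, h2⟩ | ⟨h1, h2, h3⟩
    · obtain ⟨u, hu⟩ := g_unit Q h1
      exact ⟨1, u, 0, 1, by simp, by rw [h2]; simp, by rw [mul_one]; exact hu⟩
    · obtain ⟨u, hu⟩ := g_unit P h1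
      rw [sq_abs] at h2 h3
      obtain ⟨w, hw⟩ := g_assoc T Q h2 h3
      exact ⟨u, w, 1, (1 + Zsqrtd.sqrtd) * (T : GaussianInt), by simp, by rw [mul_one]; exact hu, hw⟩
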